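/- Let z ∈ [0,1) be irrational with partial quotients satisfying a_n(z) ≤ n for all n ≥ 1, and let θ > 0. Then there exist b > 1 and a Borel probability measure μ on [0,1) with μ(F_z(b)) = 1 such that for every x ∈ F_z(b), liminf_{r→0} log μ(B(x,r)) / log r ≥ 1/2 − θ, where B(x,r) is the ball of radius r centered at x and F_z(b) = { x ∈ [0,1) ∩ ℚ^c : a_{k²}(x) ∈ (b^{k²}, 2b^{k²}] for every k ≥ 1, and a_m(x) = a_m(z) for every m ≥ 1 that is not a perfect square }. -/

import Mathlib

open Filter MeasureTheory

/-- The Gauss map `T(0) = 0`, `T(x) = 1/x mod 1`. -/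
noncomputable def gaussMap (x : ℝ) : ℝ := if x = 0 then 0 else Int.fract (1 / x)

/-- The `n`-th partial quotient `a_n(x) = ⌊1 / T^{n-1}(x)⌋` of the regular continued fraction
expansion of `x` (for `n ≥ 1`). -/
noncomputable def cfDigit (x : ℝ) (n : ℕ) : ℕ := ⌊1 / gaussMap^[n - 1] x⌋₊

/-- The Cantor-like set `F_z(b)`: irrationals `x ∈ [0,1)` with `a_{k²}(x) ∈ (b^{k²}, 2b^{k²}]`
for all `k ≥ 1`, and `a_m(x) = a_m(z)` for all non-square `m ≥ 1`. -/
def Fzb (z : ℝ) (b : ℝ) : Set ℝ :=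
  {x | x ∈ Set.Ico (0 : ℝ) 1 ∧ Irrational x ∧
    (∀ k, 1 ≤ k → b ^ (k ^ 2) < (cfDigit x (k ^ 2) : ℝ) ∧
      (cfDigit x (k ^ 2) : ℝ) ≤ 2 * b ^ (k ^ 2)) ∧
    ∀ m, 1 ≤ m → (¬∃ k, m = k ^ 2) → cfDigit x m = cfDigit z m}

namespace CantorCF

/-- The partial quotients indexed from `0`. -/
noncomputable def digit (x : ℝ) (i : ℕ) : ℕ := cfDigit x (i + 1)

lemma digit_eq (x : ℝ) (i : ℕ) : digit x i = ⌊1 / gaussMap^[i] x⌋₊ := rfl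

lemma digit_gaussMap (x : ℝ) (i : ℕ) : digit (gaussMap x) i = digit x (i + 1) := by
  simp [digit_eq]

/-- The irrational numbers in the open unit interval. -/
def IrrUnit (x : ℝ) : Prop := Irrational x ∧ 0 < x ∧ x < 1

lemma IrrUnit.of_mem_Ico {x : ℝ} (hx : x ∈ Set.Ico (0 : ℝ) 1) (h : Irrational x) : IrrUnit x :=
  ⟨h, lt_of_le_of_ne hx.1 h.ne_zero.symm, hx.2⟩

lemma IrrUnit.map {x : ℝ} (hx : IrrUnit x) : IrrUnit (gaussMap x) := by
  have h : gaussMap x = 1 / x - ⌊1 / x⌋ := by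
    rw [gaussMap, if_neg hx.2.1.ne']; rfl
  have hirr : Irrational (gaussMap x) := by
    rw [h, one_div]
    exact hx.1.inv.sub_intCast _
  have h2 : gaussMap x = Int.fract (1 / x) := by
    rw [gaussMap, if_neg hx.2.1.ne']
  refine .of_mem_Ico ⟨?_, ?_⟩ hirr
  · rw [h2]; exact Int.fract_nonneg _
  · rw [h2]; exact Int.fract_lt_one _

lemma IrrUnit.one_le_digit {x : ℝ} (hx : IrrUnit x) (i : ℕ) : 1 ≤ digit x i := by
  induction i generalizing x with
  | zero =>
    rw [digit_eq, Nat.le_floor_iff (by have := hx.2.1; simp; positivity)]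
    simpa using (one_le_one_div hx.2.1 hx.2.2.le)
  | succ i ih => rw [← digit_gaussMap]; exact ih hx.map

lemma IrrUnit.eq_inv {x : ℝ} (hx : IrrUnit x) : x = 1 / (digit x 0 + gaussMap x) := by
  have hpos := hx.2.1
  have h : (digit x 0 : ℝ) + gaussMap x = 1 / x := by
    rw [digit_eq, gaussMap, if_neg hpos.ne']
    simp only [Function.iterate_zero, id]
    rw [natCast_floor_eq_intCast_floor (by positivity)]
    exact Int.floor_add_fract _
  rw [h, one_div_one_div]

lemma gaussMap_digit_inv {a : ℕ} (ha : 1 ≤ a) {t : ℝ} (ht : 0 < t) (ht1 : t < 1) :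
    gaussMap (1 / (a + t)) = t ∧ digit (1 / (a + t)) 0 = a := by
  have ha' : (1 : ℝ) ≤ a := by exact_mod_cast ha
  have hpos : (0 : ℝ) < a + t := by positivity
  constructor
  · rw [gaussMap, if_neg (by positivity), one_div_one_div, Int.fract_natCast_add,
      Int.fract_eq_self.2 ⟨ht.le, ht1⟩]
  · rw [digit_eq]
    simp only [Function.iterate_zero, id]
    rw [one_div_one_div, Nat.floor_eq_iff hpos.le]
    constructor <;> linarith

lemma abs_inv_sub_inv {u v : ℝ} (hu : 0 < u) (hv : 0 < v) :
    |1 / u - 1 / v| = |u - v| / (u * v) := by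
  rw [div_sub_div _ _ hu.ne' hv.ne', abs_div, abs_of_pos (mul_pos hu hv), abs_sub_comm]
  ring_nf

/-- Points sharing their first `n` partial quotients are close. -/
lemma abs_sub_lt_of_digit_eq (n : ℕ) : ∀ {x y : ℝ} (c : ℕ → ℝ), IrrUnit x → IrrUnit y →
    (∀ i, 1 ≤ c i ∧ c i ≤ digit x i) → (∀ i < n, digit x i = digit y i) →
    |x - y| < ((∏ i ∈ Finset.range n, c i) ^ 2)⁻¹ := by
  induction n with
  | zero =>
    intro x y c hx hy _ _
    have := hx.2; have := hy.2
    simp only [Finset.range_zero, Finset.prod_empty, one_pow, inv_one]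
    rw [abs_lt]; constructor <;> linarith
  | succ n ih =>
    intro x y c hx hy hc h
    have key := ih (fun i => c (i + 1)) hx.map hy.map
      (fun i => by rw [digit_gaussMap]; exact hc (i + 1))
      (fun i hi => by rw [digit_gaussMap, digit_gaussMap]; exact h _ (by omega))
    have h0 := h 0 (by omega)
    have hc0 := hc 0
    have hTx := hx.map.2.1
    have hTy := hy.map.2.1
    have hD : (0 : ℝ) < digit x 0 := by linarith
    rw [Finset.prod_range_succ', hx.eq_inv, hy.eq_inv, ← h0,
      abs_inv_sub_inv (by positivity) (by positivity), add_sub_add_left_eq_sub]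
    rw [mul_pow, mul_inv, div_eq_mul_inv]
    have h1 : (((digit x 0 : ℝ) + gaussMap x) * (digit x 0 + gaussMap y))⁻¹ ≤ (c 0 ^ 2)⁻¹ := by
      apply inv_anti₀ (by have := hc0.1; positivity)
      rw [sq]
      exact mul_le_mul (by linarith) (by linarith) (by linarith) (by linarith)
    calc _ ≤ |gaussMap x - gaussMap y| * (c 0 ^ 2)⁻¹ := by gcongr
      _ < _ := by
        apply mul_lt_mul_of_pos_right key
        have := hc0.1; positivity

/-- Points whose partial quotients differ somewhere among the first `n` are far apart, provided
that a differing partial quotient is always followed by a common one. -/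
lemma le_abs_sub_of_digit_ne (n : ℕ) : ∀ {x y : ℝ} (M : ℕ → ℝ), IrrUnit x → IrrUnit y →
    (∀ i, digit x i + 1 ≤ M i) → (∀ i, digit y i + 1 ≤ M i) →
    (∀ i, digit x i ≠ digit y i → digit x (i + 1) = digit y (i + 1)) →
    (∃ i < n, digit x i ≠ digit y i) →
    (2 * (∏ i ∈ Finset.range n, M i) ^ 2)⁻¹ ≤ |x - y| := by
  induction n with
  | zero => rintro x y M - - - - - ⟨i, hi, -⟩; omega
  | succ n ih =>
    intro x y M hx hy hMx hMy hne hex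
    have hTx := hx.map.2
    have hTy := hy.map.2
    have hDx : (1 : ℝ) ≤ digit x 0 := by exact_mod_cast hx.one_le_digit 0
    have hDy : (1 : ℝ) ≤ digit y 0 := by exact_mod_cast hy.one_le_digit 0
    have hMx0 := hMx 0
    have hMy0 := hMy 0
    have hden : ((M 0) ^ 2)⁻¹ ≤
        (((digit x 0 : ℝ) + gaussMap x) * (digit y 0 + gaussMap y))⁻¹ := by
      apply inv_anti₀ (by apply mul_pos <;> linarith)
      rw [sq]
      exact mul_le_mul (by linarith) (by linarith) (by linarith) (by linarith)
    rw [Finset.prod_range_succ', hx.eq_inv, hy.eq_inv,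
      abs_inv_sub_inv (by linarith) (by linarith), mul_pow, ← mul_assoc, mul_inv,
      div_eq_mul_inv]
    by_cases h0 : digit x 0 = digit y 0
    · have key := ih (fun i => M (i + 1)) hx.map hy.map
        (fun i => by rw [digit_gaussMap]; exact hMx _)
        (fun i => by rw [digit_gaussMap]; exact hMy _)
        (fun i hi => by
          rw [digit_gaussMap, digit_gaussMap] at hi ⊢; exact hne _ hi)
        (by
          obtain ⟨i, hi, hi'⟩ := hex
          obtain _ | i := i
          · exact absurd h0 hi'
          · exact ⟨i, by omega, by rwa [digit_gaussMap, digit_gaussMap]⟩)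
      rw [h0] at hden ⊢
      rw [add_sub_add_left_eq_sub]
      exact mul_le_mul key hden (by positivity) (abs_nonneg _)
    · have h1 := hne 0 h0
      have hhalf : |gaussMap x - gaussMap y| ≤ 1 / 2 := by
        have hE : (1 : ℝ) ≤ digit y 1 := by exact_mod_cast hy.one_le_digit 1
        have hux := hx.map.map.2
        have huy := hy.map.map.2
        have hxx := hx.map.eq_inv
        have hyy := hy.map.eq_inv
        rw [digit_gaussMap] at hxx hyy
        rw [zero_add] at hxx hyy h1
        rw [h1] at hxx
        have bd : ∀ t : ℝ, 0 < t → t < 1 →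
            1 / ((digit y 1 : ℝ) + 1) ≤ 1 / ((digit y 1 : ℝ) + t) ∧
            1 / ((digit y 1 : ℝ) + t) ≤ 1 / (digit y 1 : ℝ) := fun t h0 h1 =>
          ⟨one_div_le_one_div_of_le (by linarith) (by linarith),
            one_div_le_one_div_of_le (by linarith) (by linarith)⟩
        have b1 := bd _ hux.1 hux.2
        have b2 := bd _ huy.1 huy.2
        rw [← hxx] at b1
        rw [← hyy] at b2
        have b3 : 1 / (digit y 1 : ℝ) - 1 / ((digit y 1 : ℝ) + 1) ≤ 1 / 2 := by
          rw [div_sub_div _ _ (by positivity) (by positivity), div_le_div_iff₀ (by positivity)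
            (by positivity)]
          nlinarith
        rw [abs_le]; constructor <;> linarith [b1.1, b1.2, b2.1, b2.2]
      have hint : (1 : ℝ) ≤ |(digit x 0 : ℝ) - digit y 0| := by
        have : (1 : ℤ) ≤ |(digit x 0 : ℤ) - digit y 0| := by
          apply Int.one_le_abs; omega
        exact_mod_cast this
      have hnum : (1 : ℝ) / 2 ≤ |(digit x 0 : ℝ) + gaussMap x - (digit y 0 + gaussMap y)| := by
        have : (digit x 0 : ℝ) - digit y 0 = ((digit x 0 : ℝ) + gaussMap x -
          (digit y 0 + gaussMap y)) - (gaussMap x - gaussMap y) := by ring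
        have h3 := abs_sub ((digit x 0 : ℝ) + gaussMap x - (digit y 0 + gaussMap y))
          (gaussMap x - gaussMap y)
        rw [← this] at h3
        linarith
      refine mul_le_mul (le_trans ?_ hnum) hden (by positivity) (abs_nonneg _)
      rw [one_div]
      apply inv_anti₀ (by norm_num)
      have : 1 ≤ ∏ i ∈ Finset.range n, M (i + 1) := by
        apply Finset.one_le_prod
        intro i _
        have h2 : (0 : ℝ) ≤ digit x (i + 1) := by positivity
        linarith [hMx (i + 1)]
      nlinarith

lemma exists_iterate_gaussMap_eq_zero (p : ℕ) : ∀ q : ℕ, p < q →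
    ∃ n, gaussMap^[n] ((p : ℝ) / q) = 0 := by
  induction p using Nat.strong_induction_on with
  | _ p ih =>
    intro q hq
    obtain rfl | hp := Nat.eq_zero_or_pos p
    · exact ⟨0, by simp⟩
    · obtain ⟨n, hn⟩ := ih (q % p) (Nat.mod_lt _ hp) p (Nat.mod_lt _ hp)
      refine ⟨n + 1, ?_⟩
      have hq0 : (0 : ℝ) < q := by exact_mod_cast hp.trans hq
      have hp0 : (0 : ℝ) < p := by exact_mod_cast hp
      rw [Function.iterate_succ_apply, gaussMap, if_neg (by positivity), one_div_div,
        Int.fract_div_natCast_eq_div_natCast_mod]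
      exact hn

lemma irrational_of_iterate_gaussMap_ne_zero {x : ℝ} (h0 : 0 ≤ x) (h1 : x < 1)
    (h : ∀ n, gaussMap^[n] x ≠ 0) : Irrational x := by
  rintro ⟨q, rfl⟩
  have hq0 : 0 ≤ q := by exact_mod_cast h0
  have hq1 : q < 1 := by exact_mod_cast h1
  have hcast : ((q.num.toNat : ℝ) / q.den) = (q : ℝ) := by
    have hn : ((q.num.toNat : ℤ)) = q.num := Int.toNat_of_nonneg (Rat.num_nonneg.2 hq0)
    have : (q.num.toNat : ℝ) = (q.num : ℝ) := by exact_mod_cast hn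
    rw [this]
    exact_mod_cast Rat.num_div_den q
  have hlt : q.num.toNat < q.den := by
    have := Rat.num_lt_denom_iff.2 hq1
    have := q.pos
    omega
  obtain ⟨n, hn⟩ := exists_iterate_gaussMap_eq_zero _ _ hlt
  rw [hcast] at hn
  exact h n hn

/-- The finite continued fraction `[ω 0, …, ω (n - 2), ω (n - 1) + t]`. -/
noncomputable def finiteCF : ℕ → (ℕ → ℕ) → ℝ → ℝ
  | 0, _, t => t
  | n + 1, ω, t => 1 / (ω 0 + finiteCF n (fun i => ω (i + 1)) t)

/-- The continued fraction with partial quotients `ω 0, ω 1, …`. -/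
noncomputable def infiniteCF (ω : ℕ → ℕ) : ℝ := limsup (fun n => finiteCF n ω 0) atTop

lemma measurable_finiteCF (n : ℕ) : Measurable fun ω => finiteCF n ω 0 := by
  induction n with
  | zero => exact measurable_const
  | succ n ih =>
    have h0 : Measurable fun ω : ℕ → ℕ => (ω 0 : ℝ) :=
      measurable_from_top.comp (measurable_pi_apply 0)
    have h1 : Measurable fun (ω : ℕ → ℕ) (i : ℕ) => ω (i + 1) :=
      measurable_pi_lambda _ fun i => measurable_pi_apply (i + 1)
    exact measurable_const.div (h0.add (ih.comp h1))

lemma measurable_infiniteCF : Measurable infiniteCF := .limsup measurable_finiteCF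

lemma finiteCF_succ (n : ℕ) : ∀ (ω : ℕ → ℕ) (t : ℝ),
    finiteCF (n + 1) ω t = finiteCF n ω (1 / (ω n + t)) := by
  induction n with
  | zero => intro ω t; rfl
  | succ n ih => intro ω t; rw [finiteCF, ih, finiteCF]

lemma finiteCF_mem_Icc (n : ℕ) : ∀ {ω : ℕ → ℕ}, (∀ i, 1 ≤ ω i) → ∀ {t : ℝ},
    t ∈ Set.Icc (0 : ℝ) 1 → finiteCF n ω t ∈ Set.Icc (0 : ℝ) 1 := by
  induction n with
  | zero => intro ω _ t ht; exact ht
  | succ n ih =>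
    intro ω hω t ht
    have h := (ih (fun i => hω (i + 1)) ht).1
    have h0 : (1 : ℝ) ≤ ω 0 := by exact_mod_cast hω 0
    rw [finiteCF]
    exact ⟨by positivity, div_le_one_of_le₀ (by linarith) (by linarith)⟩

lemma abs_finiteCF_sub_le (n : ℕ) : ∀ {ω : ℕ → ℕ}, (∀ i, 1 ≤ ω i) → ∀ {s t : ℝ},
    s ∈ Set.Icc (0 : ℝ) 1 → t ∈ Set.Icc (0 : ℝ) 1 →
    |finiteCF n ω s - finiteCF n ω t| ≤ 2 * (1 / 2) ^ n := by
  induction n using Nat.twoStepInduction with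
  | zero =>
    intro ω _ s t hs ht
    rw [finiteCF, finiteCF, abs_le]
    constructor <;> linarith [hs.1, hs.2, ht.1, ht.2]
  | one =>
    intro ω hω s t hs ht
    have h1 := finiteCF_mem_Icc 1 hω hs
    have h2 := finiteCF_mem_Icc 1 hω ht
    rw [abs_le]
    constructor <;> linarith [h1.1, h1.2, h2.1, h2.2]
  | more n ih _ =>
    intro ω hω s t hs ht
    have hω' : ∀ i, 1 ≤ ω (i + 1 + 1) := fun i => hω _
    have h := ih hω' hs ht
    have hu := (finiteCF_mem_Icc n hω' hs).1
    have hv := (finiteCF_mem_Icc n hω' ht).1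
    rw [finiteCF, finiteCF, finiteCF, finiteCF]
    set u := finiteCF n (fun i => ω (i + 1 + 1)) s
    set v := finiteCF n (fun i => ω (i + 1 + 1)) t
    have ha : (1 : ℝ) ≤ ω 0 := by exact_mod_cast hω 0
    have hc : (1 : ℝ) ≤ ω 1 := by exact_mod_cast hω 1
    simp only [zero_add]
    rw [abs_inv_sub_inv (by positivity) (by positivity), add_sub_add_left_eq_sub,
      abs_inv_sub_inv (by positivity) (by positivity), add_sub_add_left_eq_sub, div_div]
    have hden : 4 ≤ ((ω 1 : ℝ) + u) * (ω 1 + v) *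
        ((ω 0 + 1 / (ω 1 + u)) * (ω 0 + 1 / (ω 1 + v))) := by
      have e : ((ω 1 : ℝ) + u) * (ω 1 + v) * ((ω 0 + 1 / (ω 1 + u)) * (ω 0 + 1 / (ω 1 + v))) =
          (ω 0 * (ω 1 + u) + 1) * (ω 0 * (ω 1 + v) + 1) := by
        field_simp
      rw [e]
      have h1 : (2 : ℝ) ≤ ω 0 * (ω 1 + u) + 1 := by nlinarith
      have h2 : (2 : ℝ) ≤ ω 0 * (ω 1 + v) + 1 := by nlinarith
      nlinarith
    calc _ ≤ |u - v| / 4 := by gcongr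
      _ ≤ 2 * (1 / 2) ^ n / 4 := by gcongr
      _ = _ := by ring

lemma tendsto_finiteCF {ω : ℕ → ℕ} (hω : ∀ i, 1 ≤ ω i) :
    Tendsto (fun n => finiteCF n ω 0) atTop (nhds (infiniteCF ω)) := by
  have hc : CauchySeq fun n => finiteCF n ω 0 := by
    refine cauchySeq_of_le_geometric (1 / 2) 2 (by norm_num) fun n => ?_
    rw [Real.dist_eq, finiteCF_succ]
    have h0 : (1 : ℝ) ≤ ω n := by exact_mod_cast hω n
    refine abs_finiteCF_sub_le n hω (by simp) ⟨by positivity, ?_⟩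
    exact div_le_one_of_le₀ (by linarith) (by linarith)
  obtain ⟨a, ha⟩ := cauchySeq_tendsto_of_complete hc
  rwa [infiniteCF, ha.limsup_eq]

lemma infiniteCF_mem_Icc {ω : ℕ → ℕ} (hω : ∀ i, 1 ≤ ω i) :
    infiniteCF ω ∈ Set.Icc (0 : ℝ) 1 :=
  isClosed_Icc.mem_of_tendsto (tendsto_finiteCF hω)
    (.of_forall fun n => finiteCF_mem_Icc n hω (by simp))

lemma infiniteCF_eq {ω : ℕ → ℕ} (hω : ∀ i, 1 ≤ ω i) :
    infiniteCF ω = 1 / (ω 0 + infiniteCF fun i => ω (i + 1)) := by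
  have h0 : (1 : ℝ) ≤ ω 0 := by exact_mod_cast hω 0
  have hω' : ∀ i, 1 ≤ ω (i + 1) := fun i => hω _
  have hpos := (infiniteCF_mem_Icc hω').1
  refine tendsto_nhds_unique ((tendsto_add_atTop_iff_nat 1).2 (tendsto_finiteCF hω)) ?_
  exact (tendsto_const_nhds.div (tendsto_const_nhds.add (tendsto_finiteCF hω')) (by positivity))

lemma infiniteCF_pos {ω : ℕ → ℕ} (hω : ∀ i, 1 ≤ ω i) : 0 < infiniteCF ω := by
  have h0 : (1 : ℝ) ≤ ω 0 := by exact_mod_cast hω 0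
  have hpos := (infiniteCF_mem_Icc fun i => hω (i + 1)).1
  rw [infiniteCF_eq hω]
  positivity

lemma infiniteCF_lt_one {ω : ℕ → ℕ} (hω : ∀ i, 1 ≤ ω i) : infiniteCF ω < 1 := by
  have h0 : (1 : ℝ) ≤ ω 0 := by exact_mod_cast hω 0
  have hpos := infiniteCF_pos fun i => hω (i + 1)
  rw [infiniteCF_eq hω, div_lt_one (by positivity)]
  linarith

lemma iterate_gaussMap_infiniteCF (n : ℕ) : ∀ {ω : ℕ → ℕ}, (∀ i, 1 ≤ ω i) →
    gaussMap^[n] (infiniteCF ω) = infiniteCF fun i => ω (i + n) := by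
  induction n with
  | zero => intro ω _; rfl
  | succ n ih =>
    intro ω hω
    have hω' : ∀ i, 1 ≤ ω (i + 1) := fun i => hω _
    rw [Function.iterate_succ_apply, infiniteCF_eq hω,
      (gaussMap_digit_inv (hω 0) (infiniteCF_pos hω') (infiniteCF_lt_one hω')).1, ih hω']
    simp only [add_assoc]

lemma digit_infiniteCF {ω : ℕ → ℕ} (hω : ∀ i, 1 ≤ ω i) (n : ℕ) :
    digit (infiniteCF ω) n = ω n := by
  have h1 : ∀ i, 1 ≤ ω (i + n) := fun i => hω _
  have h2 : ∀ i, 1 ≤ ω (i + 1 + n) := fun i => hω _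
  have h := (gaussMap_digit_inv (h1 0) (infiniteCF_pos h2) (infiniteCF_lt_one h2)).2
  rw [← infiniteCF_eq h1, ← iterate_gaussMap_infiniteCF n hω, zero_add] at h
  rwa [digit_eq] at h ⊢

lemma irrUnit_infiniteCF {ω : ℕ → ℕ} (hω : ∀ i, 1 ≤ ω i) : IrrUnit (infiniteCF ω) := by
  refine ⟨irrational_of_iterate_gaussMap_ne_zero (infiniteCF_pos hω).le (infiniteCF_lt_one hω)
    fun n => ?_, infiniteCF_pos hω, infiniteCF_lt_one hω⟩
  rw [iterate_gaussMap_infiniteCF n hω]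
  exact (infiniteCF_pos fun i => hω (i + n)).ne'

open Classical in
/-- The partial quotients allowed at place `i` in `Fzb z 2`. -/
noncomputable def digitSet (z : ℝ) (i : ℕ) : Finset ℕ :=
  if ∃ k, i + 1 = k ^ 2 then Finset.Ioc (2 ^ (i + 1)) (2 * 2 ^ (i + 1)) else {digit z i}

open Classical in
/-- The number of partial quotients allowed at place `i` in `Fzb z 2`. -/
noncomputable def choices (i : ℕ) : ℕ := if ∃ k, i + 1 = k ^ 2 then 2 ^ (i + 1) else 1

/-- The number of initial blocks of length `n` of partial quotients allowed in `Fzb z 2`. -/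
noncomputable def blocks (n : ℕ) : ℝ := ∏ i ∈ Finset.range n, (choices i : ℝ)

/-- The separation scale of the cylinders of order `n` of `Fzb z 2`. -/
noncomputable def scale (n : ℕ) : ℝ :=
  (2 * (∏ i ∈ Finset.range n, (3 * (i + 1) * choices i : ℝ)) ^ 2)⁻¹

lemma card_digitSet (z : ℝ) (i : ℕ) : (digitSet z i).card = choices i := by
  unfold digitSet choices
  split_ifs
  · rw [Nat.card_Ioc]; omega
  · simp

lemma one_le_choices (i : ℕ) : 1 ≤ choices i := by
  unfold choices
  split_ifs
  · exact Nat.one_le_two_pow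
  · exact le_rfl

lemma choices_le (i : ℕ) : choices i ≤ 2 ^ (i + 1) := by
  unfold choices
  split_ifs
  · exact le_rfl
  · exact Nat.one_le_two_pow

lemma one_le_blocks (n : ℕ) : 1 ≤ blocks n :=
  Finset.one_le_prod fun i _ => by exact_mod_cast one_le_choices i

lemma digitSet_nonempty (z : ℝ) (i : ℕ) : (digitSet z i).Nonempty := by
  rw [← Finset.card_pos, card_digitSet]
  exact one_le_choices i

lemma choices_le_of_mem {z : ℝ} (hz : IrrUnit z) {i a : ℕ} (ha : a ∈ digitSet z i) :
    choices i ≤ a := by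
  unfold digitSet at ha
  unfold choices
  split_ifs at ha ⊢
  · exact (Finset.mem_Ioc.1 ha).1.le
  · rw [Finset.mem_singleton.1 ha]; exact hz.one_le_digit i

lemma add_one_le_of_mem {z : ℝ} (hdig : ∀ i, digit z i ≤ i + 1) {i a : ℕ}
    (ha : a ∈ digitSet z i) : a + 1 ≤ 3 * (i + 1) * choices i := by
  unfold digitSet at ha
  unfold choices
  split_ifs at ha ⊢
  · have h1 := (Finset.mem_Ioc.1 ha).2
    have h2 : 1 ≤ 2 ^ (i + 1) := Nat.one_le_two_pow
    nlinarith
  · rw [Finset.mem_singleton.1 ha]; have := hdig i; omega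

lemma digit_succ_eq_of_ne {z : ℝ} {ω η : ℕ → ℕ} (hω : ∀ i, ω i ∈ digitSet z i)
    (hη : ∀ i, η i ∈ digitSet z i) {i : ℕ} (h : ω i ≠ η i) : ω (i + 1) = η (i + 1) := by
  have hsq : ∃ k, i + 1 = k ^ 2 := by
    by_contra hn
    have h1 := hω i
    have h2 := hη i
    rw [digitSet, if_neg hn, Finset.mem_singleton] at h1 h2
    exact h (h1.trans h2.symm)
  have hn : ¬ ∃ k, i + 1 + 1 = k ^ 2 := by
    rintro ⟨l, hl⟩
    obtain ⟨k, hk⟩ := hsq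
    have hk1 : k ≠ 0 := by rintro rfl; omega
    have : k < l := by nlinarith
    have : 1 ≤ k := by omega
    nlinarith
  have h1 := hω (i + 1)
  have h2 := hη (i + 1)
  rw [digitSet, if_neg hn, Finset.mem_singleton] at h1 h2
  exact h1.trans h2.symm

lemma mem_Fzb_iff {z x : ℝ} :
    x ∈ Fzb z 2 ↔ IrrUnit x ∧ ∀ i, digit x i ∈ digitSet z i := by
  constructor
  · rintro ⟨h1, h2, h3, h4⟩
    refine ⟨.of_mem_Ico h1 h2, fun i => ?_⟩
    unfold digitSet
    split_ifs with h
    · obtain ⟨k, hk⟩ := h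
      have hk1 : 1 ≤ k := by
        by_contra hk0
        obtain rfl : k = 0 := by omega
        omega
      obtain ⟨h5, h6⟩ := h3 k hk1
      rw [Finset.mem_Ioc, digit, hk]
      exact ⟨by exact_mod_cast h5, by exact_mod_cast h6⟩
    · exact Finset.mem_singleton.2 (h4 _ (by omega) h)
  · rintro ⟨hx, h⟩
    refine ⟨⟨hx.2.1.le, hx.2.2⟩, hx.1, fun k hk => ?_, fun m hm hn => ?_⟩
    · obtain ⟨i, hi⟩ : ∃ i, k ^ 2 = i + 1 :=
        Nat.exists_eq_succ_of_ne_zero (pow_ne_zero 2 (by omega))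
      have hmem := h i
      rw [digitSet, if_pos ⟨k, hi.symm⟩, Finset.mem_Ioc, digit, ← hi] at hmem
      exact ⟨by exact_mod_cast hmem.1, by exact_mod_cast hmem.2⟩
    · obtain ⟨i, rfl⟩ : ∃ i, m = i + 1 := ⟨m - 1, by omega⟩
      have hmem := h i
      rw [digitSet, if_neg hn, Finset.mem_singleton] at hmem
      exact hmem

instance isProbabilityMeasure_uniformOn_digitSet (z : ℝ) (i : ℕ) :
    IsProbabilityMeasure (ProbabilityTheory.uniformOn (digitSet z i : Set ℕ)) :=
  ProbabilityTheory.isProbabilityMeasure_uniformOn (Finset.finite_toSet _)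
    (by exact_mod_cast digitSet_nonempty z i)

/-- The law of independent partial quotients, each uniform among the allowed ones. -/
noncomputable def digitLaw (z : ℝ) : Measure (ℕ → ℕ) :=
  Measure.infinitePi fun i => ProbabilityTheory.uniformOn (digitSet z i : Set ℕ)

instance (z : ℝ) : IsProbabilityMeasure (digitLaw z) := by
  unfold digitLaw; infer_instance

lemma ae_mem_digitSet (z : ℝ) : ∀ᵐ ω ∂digitLaw z, ∀ i, ω i ∈ digitSet z i := by
  refine ae_all_iff.2 fun i => ?_
  have hmp := measurePreserving_eval_infinitePi
    (fun i => ProbabilityTheory.uniformOn (digitSet z i : Set ℕ)) i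
  refine hmp.quasiMeasurePreserving.ae (p := fun a => a ∈ digitSet z i) ?_
  rw [ae_iff, ProbabilityTheory.uniformOn_eq_zero_iff (Finset.finite_toSet _)]
  ext a
  simp

lemma digitLaw_cylinder (z : ℝ) {η : ℕ → ℕ} (hη : ∀ i, η i ∈ digitSet z i) (n : ℕ) :
    (digitLaw z {ω | ∀ i < n, ω i = η i}).toReal = (blocks n)⁻¹ := by
  classical
  have hset : {ω : ℕ → ℕ | ∀ i < n, ω i = η i} =
      Set.pi (Finset.range n : Set ℕ) (fun i => {η i}) := by
    ext ω; simp
  rw [hset, digitLaw, Measure.infinitePi_pi _ (fun i _ => measurableSet_singleton _),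
    ENNReal.toReal_prod, blocks, ← Finset.prod_inv_distrib]
  refine Finset.prod_congr rfl fun i _ => ?_
  have h := ProbabilityTheory.uniformOn_apply_finset (s := digitSet z i) (t := {η i})
  rw [Finset.coe_singleton, Finset.inter_singleton_of_mem (hη i), card_digitSet] at h
  rw [h]
  simp

/-- The measure carried by `Fzb z 2`. -/
noncomputable def cantorMeasure (z : ℝ) : Measure ℝ := (digitLaw z).map infiniteCF

instance (z : ℝ) : IsProbabilityMeasure (cantorMeasure z) :=
  Measure.isProbabilityMeasure_map measurable_infiniteCF.aemeasurable

lemma cantorMeasure_Fzb {z : ℝ} (hz : IrrUnit z) : cantorMeasure z (Fzb z 2) = 1 := by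
  refine le_antisymm prob_le_one ?_
  refine le_trans ?_ (Measure.le_map_apply measurable_infiniteCF.aemeasurable _)
  rw [← measure_univ (μ := digitLaw z)]
  refine measure_mono_ae ?_
  filter_upwards [ae_mem_digitSet z] with ω hω _
  have h1 : ∀ i, 1 ≤ ω i := fun i => (one_le_choices i).trans (choices_le_of_mem hz (hω i))
  refine mem_Fzb_iff.2 ⟨irrUnit_infiniteCF h1, fun i => ?_⟩
  rw [digit_infiniteCF h1]
  exact hω i

lemma cantorMeasure_ball_le {z : ℝ} (hz : IrrUnit z) (hdig : ∀ i, digit z i ≤ i + 1) {x : ℝ}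
    (hx : x ∈ Fzb z 2) {n : ℕ} {r : ℝ} (hr : r ≤ scale n) :
    (cantorMeasure z (Metric.ball x r)).toReal ≤ (blocks n)⁻¹ := by
  obtain ⟨hx1, hx2⟩ := mem_Fzb_iff.1 hx
  rw [← digitLaw_cylinder z hx2 n, cantorMeasure,
    Measure.map_apply measurable_infiniteCF measurableSet_ball]
  refine ENNReal.toReal_mono (measure_ne_top _ _) (measure_mono_ae ?_)
  filter_upwards [ae_mem_digitSet z] with ω hω hball
  have h1 : ∀ i, 1 ≤ ω i := fun i => (one_le_choices i).trans (choices_le_of_mem hz (hω i))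
  change infiniteCF ω ∈ Metric.ball x r at hball
  rw [Metric.mem_ball, Real.dist_eq] at hball
  change ∀ i < n, ω i = digit x i
  by_contra hne
  push Not at hne
  refine absurd (le_abs_sub_of_digit_ne n (fun i => (3 * (i + 1) * choices i : ℝ))
    (irrUnit_infiniteCF h1) hx1 (fun i => ?_) (fun i => ?_) (fun i => ?_) ?_)
    (not_le.2 (hball.trans_le hr))
  · rw [digit_infiniteCF h1]; exact_mod_cast add_one_le_of_mem hdig (hω i)
  · exact_mod_cast add_one_le_of_mem hdig (hx2 i)
  · rw [digit_infiniteCF h1, digit_infiniteCF h1]; exact digit_succ_eq_of_ne hω hx2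
  · simpa only [digit_infiniteCF h1] using hne

lemma le_cantorMeasure_ball {z : ℝ} (hz : IrrUnit z) {x : ℝ}
    (hx : x ∈ Fzb z 2) {n : ℕ} {r : ℝ} (hr : (blocks n ^ 2)⁻¹ ≤ r) :
    (blocks n)⁻¹ ≤ (cantorMeasure z (Metric.ball x r)).toReal := by
  obtain ⟨hx1, hx2⟩ := mem_Fzb_iff.1 hx
  rw [← digitLaw_cylinder z hx2 n, cantorMeasure,
    Measure.map_apply measurable_infiniteCF measurableSet_ball]
  refine ENNReal.toReal_mono (measure_ne_top _ _) (measure_mono_ae ?_)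
  filter_upwards [ae_mem_digitSet z] with ω hω hcyl
  have h1 : ∀ i, 1 ≤ ω i := fun i => (one_le_choices i).trans (choices_le_of_mem hz (hω i))
  change ∀ i < n, ω i = digit x i at hcyl
  change infiniteCF ω ∈ Metric.ball x r
  rw [Metric.mem_ball, Real.dist_eq]
  refine (abs_sub_lt_of_digit_eq n (fun i => (choices i : ℝ)) (irrUnit_infiniteCF h1) hx1
    (fun i => ⟨?_, ?_⟩) (fun i hi => ?_)).trans_le hr
  · exact_mod_cast one_le_choices i
  · rw [digit_infiniteCF h1]; exact_mod_cast choices_le_of_mem hz (hω i)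
  · rw [digit_infiniteCF h1]; exact hcyl i hi

lemma blocks_succ (n : ℕ) : blocks (n + 1) = blocks n * choices n := Finset.prod_range_succ _ _

lemma monotone_blocks : Monotone blocks :=
  monotone_nat_of_le_succ fun n => by
    have h1 := one_le_blocks n
    have h2 : (1 : ℝ) ≤ choices n := by exact_mod_cast one_le_choices n
    rw [blocks_succ]
    nlinarith

lemma le_log_blocks_sq (k : ℕ) : (k : ℝ) ^ 3 / 3 * Real.log 2 ≤ Real.log (blocks (k ^ 2)) := by
  induction k with
  | zero => simp [blocks]
  | succ k ih =>
    obtain ⟨m, hm, hkm⟩ : ∃ m, (k + 1) ^ 2 = m + 1 ∧ k ^ 2 ≤ m :=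
      ⟨k ^ 2 + 2 * k, by ring, by omega⟩
    have hmono : Real.log (blocks (k ^ 2)) ≤ Real.log (blocks m) :=
      Real.log_le_log (by linarith [one_le_blocks (k ^ 2)]) (monotone_blocks hkm)
    have hc : (choices m : ℝ) = 2 ^ (m + 1) := by
      rw [choices, if_pos ⟨k + 1, hm.symm⟩]; push_cast; rfl
    have hm' : ((m + 1 : ℕ) : ℝ) = ((k : ℝ) + 1) ^ 2 := by rw [← hm]; push_cast; rfl
    rw [hm, blocks_succ, Real.log_mul (by linarith [one_le_blocks m]) (by rw [hc]; positivity),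
      hc, Real.log_pow, hm']
    have hl := Real.log_pos one_lt_two
    have hk : (0 : ℝ) ≤ k := by positivity
    have h3 : (((k + 1 : ℕ) : ℝ)) ^ 3 / 3 ≤ (k : ℝ) ^ 3 / 3 + ((k : ℝ) + 1) ^ 2 := by
      push_cast; nlinarith
    nlinarith [mul_le_mul_of_nonneg_right h3 hl.le]

lemma scale_pos (n : ℕ) : 0 < scale n := by
  have : 0 < ∏ i ∈ Finset.range n, (3 * (i + 1) * choices i : ℝ) :=
    Finset.prod_pos fun i _ => by
      have : (1 : ℝ) ≤ choices i := by exact_mod_cast one_le_choices i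
      positivity
  unfold scale
  positivity

lemma tendsto_scale : Tendsto scale atTop (nhds 0) := by
  refine squeeze_zero (fun n => (scale_pos n).le) (fun n => ?_)
    (tendsto_pow_atTop_nhds_zero_of_lt_one (r := (1 / 3 : ℝ)) (by norm_num) (by norm_num))
  have h : (3 : ℝ) ^ n ≤ ∏ i ∈ Finset.range n, (3 * (i + 1) * choices i : ℝ) := by
    rw [← Finset.card_range n, ← Finset.prod_const, Finset.card_range]
    refine Finset.prod_le_prod (fun _ _ => by norm_num) fun i _ => ?_
    have : (1 : ℝ) ≤ choices i := by exact_mod_cast one_le_choices i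
    have : (0 : ℝ) ≤ i := by positivity
    nlinarith
  have h1 : (1 : ℝ) ≤ 3 ^ n := one_le_pow₀ (by norm_num)
  rw [one_div, inv_pow]
  exact inv_anti₀ (by positivity) (by nlinarith)

lemma neg_log_scale_succ_le (n : ℕ) : -Real.log (scale (n + 1)) ≤
    Real.log 2 + 2 * ((n + 1) * (Real.log (3 * (n + 1)) + Real.log 2)) +
      2 * Real.log (blocks n) := by
  have hb := one_le_blocks n
  have hle : ∏ i ∈ Finset.range (n + 1), (3 * (i + 1) * choices i : ℝ) ≤
      (3 * (n + 1)) ^ (n + 1) * (blocks n * 2 ^ (n + 1)) := by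
    rw [Finset.prod_mul_distrib]
    change _ * blocks (n + 1) ≤ _
    have hc : (choices n : ℝ) ≤ 2 ^ (n + 1) := by exact_mod_cast choices_le n
    have h1 : ∏ i ∈ Finset.range (n + 1), (3 * (i + 1) : ℝ) ≤ (3 * (n + 1)) ^ (n + 1) := by
      conv_rhs => rw [← Finset.card_range (n + 1), ← Finset.prod_const]
      refine Finset.prod_le_prod (fun _ _ => by positivity) fun i hi => ?_
      have : (i : ℝ) ≤ n := by exact_mod_cast Nat.lt_succ_iff.1 (Finset.mem_range.1 hi)
      linarith
    rw [blocks_succ]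
    gcongr
  have hpos : 0 < ∏ i ∈ Finset.range (n + 1), (3 * (i + 1) * choices i : ℝ) :=
    Finset.prod_pos fun i _ => by
      have : (1 : ℝ) ≤ choices i := by exact_mod_cast one_le_choices i
      positivity
  have hlog := Real.log_le_log hpos hle
  rw [Real.log_mul (by positivity) (by positivity), Real.log_mul (by positivity) (by positivity),
    Real.log_pow, Real.log_pow] at hlog
  rw [scale, Real.log_inv, neg_neg, Real.log_mul (by norm_num) (by positivity), Real.log_pow]
  push_cast at hlog ⊢
  linarith

lemma eventually_neg_log_scale_le {δ : ℝ} (hδ : 0 < δ) :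
    ∀ᶠ n in atTop, -Real.log (scale (n + 1)) ≤ (2 + δ) * Real.log (blocks n) := by
  have hl := Real.log_pos one_lt_two
  set η := δ * Real.log 2 / 48 with hη
  have hη0 : 0 < η := by positivity
  have ev : ∀ᶠ x : ℝ in atTop, Real.log 12 + 2 * Real.log x ≤ η * x := by
    filter_upwards [Real.isLittleO_log_id_atTop.def (c := η / 4) (by positivity),
      eventually_ge_atTop (2 / η * Real.log 12), eventually_ge_atTop 0] with x h1 h2 h3
    rw [Real.norm_eq_abs, Real.norm_eq_abs, id, abs_of_nonneg h3] at h1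
    have h4 : Real.log 12 ≤ η / 2 * x := by
      calc Real.log 12 = η / 2 * (2 / η * Real.log 12) := by field_simp
        _ ≤ _ := by gcongr
    linarith [le_abs_self (Real.log x)]
  obtain ⟨K, hK⟩ := eventually_atTop.1 (tendsto_natCast_atTop_atTop.eventually ev)
  filter_upwards [eventually_ge_atTop ((K + 1) ^ 2)] with n hn
  obtain ⟨k, hk⟩ : ∃ k, k = Nat.sqrt n := ⟨_, rfl⟩
  have hKk : K + 1 ≤ k := by rw [hk]; exact Nat.le_sqrt'.2 hn
  have hkn : k ^ 2 ≤ n := by rw [hk]; exact Nat.sqrt_le' n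
  have hnk : n + 1 ≤ (k + 1) ^ 2 := by rw [hk]; exact Nat.lt_succ_sqrt' n
  have hx := hK (k + 1) (by omega)
  have hk1 : (1 : ℝ) ≤ k := by exact_mod_cast (by omega : 1 ≤ k)
  have hnk' : (n : ℝ) + 1 ≤ ((k : ℝ) + 1) ^ 2 := by exact_mod_cast hnk
  have hB : (k : ℝ) ^ 3 / 3 * Real.log 2 ≤ Real.log (blocks n) :=
    (le_log_blocks_sq k).trans
      (Real.log_le_log (by linarith [one_le_blocks (k ^ 2)]) (monotone_blocks hkn))
  push_cast at hx
  set N : ℝ := (k : ℝ) + 1 with hN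
  have hN1 : 1 ≤ N := by linarith
  have e1 : Real.log (3 * (n + 1)) ≤ Real.log 3 + 2 * Real.log N := by
    have : Real.log (3 * ((n : ℝ) + 1)) ≤ Real.log (3 * N ^ 2) :=
      Real.log_le_log (by positivity) (by linarith)
    rwa [Real.log_mul (y := N ^ 2) (by norm_num) (by positivity), Real.log_pow,
      Nat.cast_ofNat] at this
  have e2 : Real.log 12 = Real.log 3 + Real.log 2 + Real.log 2 := by
    rw [← Real.log_mul (by norm_num) (by norm_num), ← Real.log_mul (by norm_num) (by norm_num)]
    norm_num
  have hlogN : 0 ≤ Real.log N := Real.log_nonneg hN1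
  have hlog3 : 0 ≤ Real.log 3 := Real.log_nonneg (by norm_num)
  have e3 : (n + 1) * (Real.log (3 * (n + 1)) + Real.log 2) ≤
      N ^ 2 * (η * N - Real.log 2) := by
    have : Real.log (3 * (n + 1)) + Real.log 2 ≤ η * N - Real.log 2 := by linarith
    have h0 : 0 ≤ η * N - Real.log 2 := by linarith
    exact (mul_le_mul_of_nonneg_left this (by positivity)).trans
      (mul_le_mul_of_nonneg_right hnk' h0)
  have e4 : N ^ 3 ≤ 8 * (k : ℝ) ^ 3 := by
    calc N ^ 3 ≤ (2 * (k : ℝ)) ^ 3 := by gcongr; linarith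
      _ = _ := by ring
  have e5 : 2 * η * N ^ 3 ≤ δ * ((k : ℝ) ^ 3 / 3 * Real.log 2) := by
    calc 2 * η * N ^ 3 ≤ 2 * η * (8 * (k : ℝ) ^ 3) := by gcongr
      _ = _ := by rw [hη]; ring
  have e6 : Real.log 2 ≤ 2 * (N ^ 2 * Real.log 2) := by nlinarith
  have e7 := mul_le_mul_of_nonneg_left hB hδ.le
  have e8 := neg_log_scale_succ_le n
  nlinarith

lemma tendsto_inv_blocks_sq :
    Tendsto (fun k : ℕ => (blocks (k ^ 2) ^ 2)⁻¹) atTop (nhdsWithin 0 (Set.Ioi 0)) := by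
  refine tendsto_inv_atTop_nhdsGT_zero.comp ((tendsto_pow_atTop two_ne_zero).comp ?_)
  have hl := Real.log_pos one_lt_two
  refine tendsto_atTop_mono (fun k => ?_)
    ((tendsto_natCast_atTop_atTop (R := ℝ)).atTop_mul_const (r := Real.log 2 / 3) (by positivity))
  have hb := one_le_blocks (k ^ 2)
  have h1 := le_log_blocks_sq k
  have h2 := Real.log_le_sub_one_of_pos (by linarith : 0 < blocks (k ^ 2))
  have h3 : (k : ℝ) ≤ (k : ℝ) ^ 3 := by exact_mod_cast Nat.le_self_pow (by norm_num) k
  nlinarith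

lemma cantorMeasure_ball_pos {z : ℝ} (hz : IrrUnit z) {x : ℝ} (hx : x ∈ Fzb z 2) {r : ℝ}
    (hr : 0 < r) : 0 < (cantorMeasure z (Metric.ball x r)).toReal := by
  obtain ⟨k, hk⟩ := ((tendsto_nhds_of_tendsto_nhdsWithin tendsto_inv_blocks_sq).eventually_lt_const
    hr).exists
  refine lt_of_lt_of_le ?_ (le_cantorMeasure_ball hz hx hk.le)
  have := one_le_blocks (k ^ 2)
  positivity

lemma frequently_log_ball_div_log_le {z : ℝ} (hz : IrrUnit z) {x : ℝ} (hx : x ∈ Fzb z 2) :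
    ∃ᶠ r in nhdsWithin 0 (Set.Ioi 0),
      Real.log (cantorMeasure z (Metric.ball x r)).toReal / Real.log r ≤ 1 / 2 := by
  refine tendsto_inv_blocks_sq.frequently (Eventually.frequently (.of_forall fun k => ?_))
  have hb := one_le_blocks (k ^ 2)
  have h := Real.log_le_log (by positivity) (le_cantorMeasure_ball hz hx (n := k ^ 2) le_rfl)
  have h0 := Real.log_nonneg hb
  rw [Real.log_inv] at h
  rw [Real.log_inv, Real.log_pow, Nat.cast_ofNat]
  obtain h1 | h1 := h0.eq_or_lt
  · simp [← h1]
  · rw [div_le_iff_of_neg (by linarith)]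
    linarith

lemma eventually_le_log_ball_div_log {z : ℝ} (hz : IrrUnit z) (hdig : ∀ i, digit z i ≤ i + 1)
    {x : ℝ} (hx : x ∈ Fzb z 2) {θ : ℝ} (hθ : 0 < θ) :
    ∀ᶠ r in nhdsWithin 0 (Set.Ioi 0),
      1 / 2 - θ ≤ Real.log (cantorMeasure z (Metric.ball x r)).toReal / Real.log r := by
  obtain ⟨N, hN⟩ := eventually_atTop.1 (eventually_neg_log_scale_le (δ := 4 * θ) (by positivity))
  have hsmall : ∀ᶠ r in nhdsWithin (0 : ℝ) (Set.Ioi 0), ∀ i ∈ Finset.range (N + 1), r < scale i :=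
    (Filter.eventually_all_finset _).2 fun i _ =>
      eventually_nhdsWithin_of_eventually_nhds (eventually_lt_nhds (scale_pos i))
  filter_upwards [hsmall, self_mem_nhdsWithin,
    eventually_nhdsWithin_of_eventually_nhds (eventually_lt_nhds one_pos)] with r h1 h2 h3
  have hr : 0 < r := h2
  have hex : ∃ n, scale n < r := (tendsto_scale.eventually_lt_const hr).exists
  classical
  obtain ⟨m, hm⟩ : ∃ m, Nat.find hex = m + 1 := by
    refine Nat.exists_eq_succ_of_ne_zero fun h0 => ?_
    have hs := Nat.find_spec hex
    rw [h0] at hs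
    exact (h1 0 (by simp)).not_gt hs
  have hs := Nat.find_spec hex
  rw [hm] at hs
  have hrm : r ≤ scale m := not_lt.1 (Nat.find_min hex (by omega))
  have hNm : N ≤ m := by
    by_contra hlt
    exact (h1 (m + 1) (Finset.mem_range.2 (by omega))).not_gt hs
  have hlog := hN m hNm
  have hlogr := Real.log_lt_log (scale_pos _) hs
  have hmu := Real.log_le_log (cantorMeasure_ball_pos hz hx hr)
    (cantorMeasure_ball_le hz hdig hx hrm)
  rw [Real.log_inv] at hmu
  have hL := Real.log_nonneg (one_le_blocks m)
  have hneg := Real.log_neg hr h3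
  rw [le_div_iff_of_neg hneg]
  obtain hθ' | hθ' := le_total (1 / 2 - θ) 0
  · nlinarith
  · nlinarith [mul_le_mul_of_nonneg_left (by linarith :
      -Real.log r ≤ (2 + 4 * θ) * Real.log (blocks m)) hθ', mul_nonneg (sq_nonneg θ) hL]

end CantorCF

/-- If `z ∈ [0,1)` is irrational with `a_n(z) ≤ n` for all `n ≥ 1` and `θ > 0`, then there are
`b > 1` and a Borel probability measure `μ` with `μ(F_z(b)) = 1` such that for every
`x ∈ F_z(b)`, `liminf_{r → 0⁺} (log μ(B(x,r)) / log r) ≥ 1/2 - θ`. -/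
theorem stmt16 (z : ℝ) (hz : z ∈ Set.Ico (0 : ℝ) 1) (hirr : Irrational z)
    (hdig : ∀ n, 1 ≤ n → cfDigit z n ≤ n) (θ : ℝ) (hθ : 0 < θ) :
    ∃ b : ℝ, 1 < b ∧ ∃ μ : Measure ℝ, IsProbabilityMeasure μ ∧ μ (Fzb z b) = 1 ∧
      ∀ x ∈ Fzb z b,
        (1 / 2 - θ : ℝ) ≤
          liminf (fun r => Real.log (μ (Metric.ball x r)).toReal / Real.log r)
            (nhdsWithin 0 (Set.Ioi 0)) := by
  have hz' : CantorCF.IrrUnit z := .of_mem_Ico hz hirr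
  refine ⟨2, one_lt_two, CantorCF.cantorMeasure z, inferInstance,
    CantorCF.cantorMeasure_Fzb hz', fun x hx => le_liminf_of_le ?_ ?_⟩
  · exact .of_frequently_le (CantorCF.frequently_log_ball_div_log_le hz' hx)
  · exact CantorCF.eventually_le_log_ball_div_log hz' (fun i => hdig (i + 1) (by omega)) hx hθ
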